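/- In the ring A ⊗_ℚ A, where A = ℚ[x₁,x₂,x₃]/(σ₁,σ₂,σ₃), the averaging operator satisfies ρ(x₁ ⊗ x₂) = −(1/6)(x₁ ⊗ x₁ + x₂ ⊗ x₂ + x₃ ⊗ x₃) and ρ(x₁x₂ ⊗ x₂x₃) = −(1/6)(x₁x₂ ⊗ x₁x₂ + x₂x₃ ⊗ x₂x₃ + x₁x₃ ⊗ x₁x₃). -/

import Mathlib

set_option maxHeartbeats 1000000
set_option synthInstance.maxHeartbeats 400000

open MvPolynomial TensorProduct

/-- The ideal `(σ₁, σ₂, σ₃)` of elementary symmetric polynomials. -/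
noncomputable abbrev symIdeal : Ideal (MvPolynomial (Fin 3) ℚ) :=
  Ideal.span {esymm (Fin 3) ℚ 1, esymm (Fin 3) ℚ 2, esymm (Fin 3) ℚ 3}

/-- `A = ℚ[x₁,x₂,x₃]/(σ₁,σ₂,σ₃)`, the rational cohomology ring of `Fl₃(ℂ)`. -/
noncomputable abbrev FlagRing := MvPolynomial (Fin 3) ℚ ⧸ symIdeal

/-- The generators `x₁, x₂, x₃` of `A` (indexed by `Fin 3`). -/
noncomputable def xx (i : Fin 3) : FlagRing := Ideal.Quotient.mk symIdeal (X i)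

lemma rename_mem_symIdeal (g : Equiv.Perm (Fin 3)) {a : MvPolynomial (Fin 3) ℚ}
    (ha : a ∈ symIdeal) : rename (⇑g) a ∈ symIdeal := by
  have h : symIdeal.map (rename (⇑g)).toRingHom ≤ symIdeal := by
    rw [Ideal.map_span]
    refine Ideal.span_le.2 ?_
    rintro x ⟨y, hy, rfl⟩
    simp only [Set.mem_insert_iff, Set.mem_singleton_iff] at hy
    rcases hy with rfl | rfl | rfl <;>
      · show (rename (⇑g)) _ ∈ _
        rw [rename_esymm]
        apply Ideal.subset_span
        simp
  exact h (Ideal.mem_map_of_mem _ ha)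

/-- The action of `ω ∈ Σ₃` on `A` by permuting the variables. -/
noncomputable def permAct (g : Equiv.Perm (Fin 3)) : FlagRing →ₐ[ℚ] FlagRing :=
  Ideal.Quotient.liftₐ symIdeal
    ((Ideal.Quotient.mkₐ ℚ symIdeal).comp (rename (⇑g)))
    (fun a ha => by
      show Ideal.Quotient.mkₐ ℚ symIdeal (rename (⇑g) a) = 0
      rw [Ideal.Quotient.mkₐ_eq_mk]
      exact Ideal.Quotient.eq_zero_iff_mem.2 (rename_mem_symIdeal g ha))

/-- The diagonal action of `ω ∈ Σ₃` on `A ⊗_ℚ A`. -/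
noncomputable def permActT (g : Equiv.Perm (Fin 3)) :
    FlagRing ⊗[ℚ] FlagRing →ₐ[ℚ] FlagRing ⊗[ℚ] FlagRing :=
  Algebra.TensorProduct.map (permAct g) (permAct g)

/-- The averaging operator `ρ(f) = (1/6) ∑_{ω ∈ Σ₃} ω·f` on `A ⊗_ℚ A`. -/
noncomputable def avg (f : FlagRing ⊗[ℚ] FlagRing) : FlagRing ⊗[ℚ] FlagRing :=
  (6 : ℚ)⁻¹ • ∑ g : Equiv.Perm (Fin 3), permActT g f

lemma permAct_xx (g : Equiv.Perm (Fin 3)) (i : Fin 3) : permAct g (xx i) = xx (g i) := by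
  change Ideal.Quotient.mk symIdeal (rename (⇑g) (X i)) = _
  rw [rename_X, xx]

lemma sum_xx : xx 0 + xx 1 + xx 2 = 0 := by
  have h : Ideal.Quotient.mk symIdeal (esymm (Fin 3) ℚ 1) = 0 :=
    Ideal.Quotient.eq_zero_iff_mem.2 (Ideal.subset_span (by simp))
  simpa [esymm_one, Fin.sum_univ_three, xx] using h

lemma sum_xx_mul_xx : xx 1 * xx 2 + xx 0 * xx 2 + xx 0 * xx 1 = 0 := by
  have h : Ideal.Quotient.mk symIdeal (esymm (Fin 3) ℚ 2) = 0 :=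
    Ideal.Quotient.eq_zero_iff_mem.2 (Ideal.subset_span (by simp))
  have hs : Finset.powersetCard 2 (Finset.univ : Finset (Fin 3)) = {{1, 2}, {0, 2}, {0, 1}} := by
    decide
  have e : esymm (Fin 3) ℚ 2 = X 1 * X 2 + X 0 * X 2 + X 0 * X 1 := by
    rw [esymm, hs, Finset.sum_insert (by decide), Finset.sum_insert (by decide),
      Finset.sum_singleton, Finset.prod_pair (by decide), Finset.prod_pair (by decide),
      Finset.prod_pair (by decide), add_assoc]
  simpa only [e, map_add, map_mul, xx] using h

lemma univ_perm_fin_three : (Finset.univ : Finset (Equiv.Perm (Fin 3))) =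
    {1, Equiv.swap 0 1, Equiv.swap 0 2, Equiv.swap 1 2,
      Equiv.swap 0 1 * Equiv.swap 1 2, Equiv.swap 1 2 * Equiv.swap 0 1} := by
  decide

lemma sum_perm_fin_three {M : Type*} [AddCommMonoid M] (f : Fin 3 → Fin 3 → M) {i j : Fin 3}
    (hij : i ≠ j) : ∑ g : Equiv.Perm (Fin 3), f (g i) (g j) =
      f 0 1 + f 1 0 + f 0 2 + f 2 0 + f 1 2 + f 2 1 := by
  rw [univ_perm_fin_three]
  repeat rw [Finset.sum_insert (by decide)]
  rw [Finset.sum_singleton]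
  fin_cases i <;> fin_cases j <;> first | exact absurd rfl hij | skip
  all_goals
    simp [Equiv.swap_apply_def]
    abel

/-- Averaging `y i ⊗ y j`, `i ≠ j`, for a permuted family `y` with zero sum. -/
lemma avg_tmul_of_sum_eq_zero (y : Fin 3 → FlagRing) (hsum : y 0 + y 1 + y 2 = 0)
    (hy : ∀ g i, permAct g (y i) = y (g i)) {i j : Fin 3} (hij : i ≠ j) :
    avg (y i ⊗ₜ[ℚ] y j) =
      -((6 : ℚ)⁻¹ • (y 0 ⊗ₜ[ℚ] y 0 + y 1 ⊗ₜ[ℚ] y 1 + y 2 ⊗ₜ[ℚ] y 2)) := by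
  have h : (y 0 + y 1 + y 2) ⊗ₜ[ℚ] (y 0 + y 1 + y 2) = 0 := by rw [hsum, zero_tmul]
  simp only [add_tmul, tmul_add] at h
  simp only [avg, permActT, Algebra.TensorProduct.map_tmul, hy]
  rw [sum_perm_fin_three (fun a b => y a ⊗ₜ[ℚ] y b) hij,
    eq_neg_iff_add_eq_zero, ← smul_add]
  refine (congrArg _ ?_).trans (smul_zero _)
  rw [← h]
  abel

/-- In `A ⊗_ℚ A`, `ρ(x₁ ⊗ x₂) = −(1/6)(x₁ ⊗ x₁ + x₂ ⊗ x₂ + x₃ ⊗ x₃)` and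
`ρ(x₁x₂ ⊗ x₂x₃) = −(1/6)(x₁x₂ ⊗ x₁x₂ + x₂x₃ ⊗ x₂x₃ + x₁x₃ ⊗ x₁x₃)`. -/
theorem avg_eval :
    avg (xx 0 ⊗ₜ[ℚ] xx 1) =
      -((6 : ℚ)⁻¹ • (xx 0 ⊗ₜ[ℚ] xx 0 + xx 1 ⊗ₜ[ℚ] xx 1 + xx 2 ⊗ₜ[ℚ] xx 2)) ∧
    avg ((xx 0 * xx 1) ⊗ₜ[ℚ] (xx 1 * xx 2)) =
      -((6 : ℚ)⁻¹ • ((xx 0 * xx 1) ⊗ₜ[ℚ] (xx 0 * xx 1) +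
        (xx 1 * xx 2) ⊗ₜ[ℚ] (xx 1 * xx 2) + (xx 0 * xx 2) ⊗ₜ[ℚ] (xx 0 * xx 2))) := by
  refine ⟨avg_tmul_of_sum_eq_zero xx sum_xx permAct_xx (by decide), ?_⟩
  have h := avg_tmul_of_sum_eq_zero ![xx 1 * xx 2, xx 0 * xx 2, xx 0 * xx 1] sum_xx_mul_xx
    (fun g i => by
      have hg : g ∈ (Finset.univ : Finset (Equiv.Perm (Fin 3))) := Finset.mem_univ g
      rw [univ_perm_fin_three] at hg
      simp only [Finset.mem_insert, Finset.mem_singleton] at hg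
      rcases hg with rfl | rfl | rfl | rfl | rfl | rfl <;> fin_cases i <;>
        simp [permAct_xx, Equiv.swap_apply_def, mul_comm])
    (i := 2) (j := 0) (by decide)
  simp only [Matrix.cons_val] at h
  rw [h]
  congr 2
  abel
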